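/- arXiv:1405.6429 — 8 statements merged into one kernel-verified Lean document; each statement's English description precedes it below -/
import Mathlib

section
/- Let α > 0 and let z ∈ ℂ ∖ [1, ∞). Let H be a complex Hilbert space with Hilbert basis (e_k)_{k≥1}, and let T_z be the bounded diagonal operator determined by T_z e_k = (i / (2 f_{k²}(z))) e_k, where f_{k²}(z) = i·√(k² - z) with √ the principal branch. Then there exists a nonzero f ∈ H with f = α T_z f if and only if z = k² - α²/4 for some positive integer k. -/
/-- Birman–Schwinger characterization of the eigenvalues of the waveguide with
a perpendicular δ-wire: for `α > 0`, `z ∈ ℂ ∖ [1, ∞)` and the bounded diagonal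
operator `T_z e_k = (i / (2 f_{k²}(z))) e_k` (with
`f_{k²}(z) = i √(k² - z)`, principal branch) in a Hilbert basis `(e_k)_{k ≥ 1}`,
there is a nonzero `f` with `f = α T_z f` iff `z = k² - α²/4` for some `k ≥ 1`. -/
theorem stmt_6 {H : Type*} [NormedAddCommGroup H] [InnerProductSpace ℂ H] [CompleteSpace H]
    (α : ℝ) (hα : 0 < α) (z : ℂ)
    (hz : z ∉ (fun x : ℝ => (x : ℂ)) '' Set.Ici (1 : ℝ))
    (e : HilbertBasis ℕ+ ℂ H) (T : H →L[ℂ] H)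
    (hT : ∀ k : ℕ+, T (e k) =
      (Complex.I / (2 * (Complex.I * ((((k : ℕ) : ℂ)) ^ 2 - z) ^ (1 / 2 : ℂ)))) • e k) :
    (∃ f : H, f ≠ 0 ∧ f = (α : ℂ) • T f) ↔
      ∃ k : ℕ+, z = (((k : ℕ) : ℂ)) ^ 2 - (α : ℂ) ^ 2 / 4 := by
  have hsq : ∀ w : ℂ, (w ^ (1 / 2 : ℂ)) ^ 2 = w := by
    intro w
    have h := Complex.cpow_nat_inv_pow w (n := 2) (by norm_num)
    simpa using h
  constructor
  · rintro ⟨f, hf0, hf⟩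
    have hk : ∃ k, e.repr f k ≠ 0 := by
      by_contra hcon
      push Not at hcon
      apply hf0
      have h1 : e.repr f = 0 := by
        ext k
        simpa using hcon k
      simpa using h1
    obtain ⟨k, hk⟩ := hk
    refine ⟨k, ?_⟩
    have hsum := ((e.hasSum_repr f).mapL T).mapL (innerSL ℂ (e k))
    have hsum2 := hasSum_single (f := fun i => innerSL ℂ (e k) (T (e.repr f i • e i))) k (by
      intro j hj
      have := e.orthonormal.2 hj.symm
      simp [hT, inner_smul_right, this])
    have huniq := hsum.unique hsum2
    have hnorm : inner ℂ (e k) (e k) = (1 : ℂ) := by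
      rw [inner_self_eq_norm_sq_to_K, e.orthonormal.1 k]; simp
    have hrep : e.repr f k = (α : ℂ) * inner ℂ (e k) (T f) := by
      rw [← inner_smul_right, ← hf, e.repr_apply_apply]
    have h2 : inner ℂ (e k) (T f) = e.repr f k *
        (Complex.I / (2 * (Complex.I * ((((k : ℕ) : ℂ)) ^ 2 - z) ^ (1 / 2 : ℂ)))) := by
      have h3 := huniq
      simp only [innerSL_apply_apply, map_smul, hT, inner_smul_right, hnorm, mul_one, smul_eq_mul] at h3
      exact h3
    rw [h2] at hrep
    have hs := hsq ((((k : ℕ) : ℂ)) ^ 2 - z)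
    generalize ((((k : ℕ) : ℂ)) ^ 2 - z) ^ (1 / 2 : ℂ) = s at hrep hs
    have hs0 : s ≠ 0 := by
      rintro rfl
      simp at hrep
      exact hk hrep
    have h5 : (α : ℂ) = 2 * s := by
      have hI := Complex.I_ne_zero
      field_simp at hrep
      first
        | linear_combination -hrep
        | linear_combination hrep
    rw [h5]
    linear_combination hs
  · rintro ⟨k, hk⟩
    refine ⟨e k, e.orthonormal.ne_zero k, ?_⟩
    have hα' : (α : ℂ) ≠ 0 := by exact_mod_cast hα.ne'
    have h1 : ((((k : ℕ) : ℂ)) ^ 2 - z) ^ (1 / 2 : ℂ) = (α : ℂ) / 2 := by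
      have h2 : (((k : ℕ) : ℂ)) ^ 2 - z = (((α / 2) ^ 2 : ℝ) : ℂ) := by
        rw [hk]; push_cast; ring
      have h3 : ((1 / 2 : ℂ)) = (((1 / 2 : ℝ)) : ℂ) := by push_cast; rfl
      rw [h2, h3, ← Complex.ofReal_cpow (by positivity), ← Real.sqrt_eq_rpow,
        Real.sqrt_sq (by positivity)]
      push_cast; rfl
    rw [hT, h1, smul_smul]
    have hI := Complex.I_ne_zero
    have : (α : ℂ) * (Complex.I / (2 * (Complex.I * ((α : ℂ) / 2)))) = 1 := by
      field_simp
    rw [this, one_smul]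
end

section
/- Let k and n be distinct positive integers with |k - n| odd. Then N_{k,n} := ∫₀^π ∫₀^π |x - y|² · sin(kx) sin(nx) sin(ky) sin(ny) dx dy = -32 k² n² / (n² - k²)⁴. -/
open Real

lemma aux_cos0 (a : ℝ) (ha : a ≠ 0) (hs : Real.sin (a * π) = 0) :
    ∫ x in (0 : ℝ)..π, Real.cos (a * x) = 0 := by
  have h : ∀ x ∈ Set.uIcc (0:ℝ) π, HasDerivAt (fun x => Real.sin (a * x) / a) (Real.cos (a * x)) x := by
    intro x _
    have h1 : HasDerivAt (fun x : ℝ => a * x) a x := by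
      simpa using (hasDerivAt_id x).const_mul a
    refine ((h1.sin).div_const a).congr_deriv ?_
    field_simp
  rw [intervalIntegral.integral_eq_sub_of_hasDerivAt h
    (Continuous.intervalIntegrable (by fun_prop) _ _)]
  simp [hs]

lemma aux_cos1 (a : ℝ) (ha : a ≠ 0) (hs : Real.sin (a * π) = 0) (hc : Real.cos (a * π) = -1) :
    ∫ x in (0 : ℝ)..π, x * Real.cos (a * x) = -2 / a ^ 2 := by
  have h : ∀ x ∈ Set.uIcc (0:ℝ) π, HasDerivAt
      (fun x => x * Real.sin (a * x) / a + Real.cos (a * x) / a ^ 2) (x * Real.cos (a * x)) x := by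
    intro x _
    have h1 : HasDerivAt (fun x : ℝ => a * x) a x := by
      simpa using (hasDerivAt_id x).const_mul a
    refine ((((hasDerivAt_id' x).mul h1.sin).div_const a).add (h1.cos.div_const (a ^ 2))).congr_deriv ?_
    field_simp
    ring
  rw [intervalIntegral.integral_eq_sub_of_hasDerivAt h
    (Continuous.intervalIntegrable (by fun_prop) _ _)]
  simp [hs, hc]
  field_simp
  ring

lemma aux_odd (m : ℤ) (hm : Odd m) : (m : ℝ) ≠ 0 ∧ Real.sin (m * π) = 0 ∧ Real.cos (m * π) = -1 := by
  refine ⟨?_, Real.sin_int_mul_pi m, ?_⟩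
  · have : m ≠ 0 := by rintro rfl; simp at hm
    exact_mod_cast this
  · rw [Real.cos_int_mul_pi, hm.neg_one_zpow]

/-- For distinct positive integers `k`, `n` with `|k - n|` odd,
`N_{k,n} = ∫₀^π ∫₀^π |x - y|² sin(kx) sin(nx) sin(ky) sin(ny) dx dy
        = -32 k² n² / (n² - k²)⁴`. -/
theorem stmt_9 (k n : ℕ) (hk : 0 < k) (hn : 0 < n) (hkn : k ≠ n)
    (hodd : Odd ((k : ℤ) - n)) :
    ∫ y in (0 : ℝ)..π, ∫ x in (0 : ℝ)..π,
        |x - y| ^ 2 * (Real.sin (k * x) * Real.sin (n * x) *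
          Real.sin (k * y) * Real.sin (n * y)) =
      -32 * (k : ℝ) ^ 2 * (n : ℝ) ^ 2 / ((n : ℝ) ^ 2 - (k : ℝ) ^ 2) ^ 4 := by
  have hodd' : Odd ((k : ℤ) + n) := by
    have : (k : ℤ) + n = (k - n) + 2 * n := by ring
    rw [this]
    exact hodd.add_even (even_two_mul _)
  obtain ⟨a0, as, ac⟩ := aux_odd _ hodd
  obtain ⟨b0, bs, bc⟩ := aux_odd _ hodd'
  push_cast at a0 as ac b0 bs bc
  set f : ℝ → ℝ := fun x => Real.sin (k * x) * Real.sin (n * x) with hf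
  have hfc : Continuous f := by fun_prop
  have hfe : ∀ x, f x = (1/2) * Real.cos (((k:ℝ) - n) * x) - (1/2) * Real.cos (((k:ℝ) + n) * x) := by
    intro x
    rw [sub_mul, add_mul, Real.cos_sub, Real.cos_add]
    simp only [hf]; ring
  have M0 : ∫ x in (0:ℝ)..π, f x = 0 := by
    simp_rw [hfe]
    rw [intervalIntegral.integral_sub (Continuous.intervalIntegrable (by fun_prop) _ _)
      (Continuous.intervalIntegrable (by fun_prop) _ _), intervalIntegral.integral_const_mul,
      intervalIntegral.integral_const_mul, aux_cos0 _ a0 as, aux_cos0 _ b0 bs]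
    simp
  have M1 : ∫ x in (0:ℝ)..π, x * f x = -1 / ((k:ℝ) - n) ^ 2 + 1 / ((k:ℝ) + n) ^ 2 := by
    have : ∀ x, x * f x = (1/2) * (x * Real.cos (((k:ℝ) - n) * x))
        - (1/2) * (x * Real.cos (((k:ℝ) + n) * x)) := by
      intro x; rw [hfe]; ring
    simp_rw [this]
    rw [intervalIntegral.integral_sub (Continuous.intervalIntegrable (by fun_prop) _ _)
      (Continuous.intervalIntegrable (by fun_prop) _ _), intervalIntegral.integral_const_mul,
      intervalIntegral.integral_const_mul, aux_cos1 _ a0 as ac, aux_cos1 _ b0 bs bc]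
    ring
  have inner : ∀ y : ℝ, ∫ x in (0 : ℝ)..π,
        |x - y| ^ 2 * (Real.sin (k * x) * Real.sin (n * x) *
          Real.sin (k * y) * Real.sin (n * y)) =
      (∫ x in (0:ℝ)..π, x ^ 2 * f x) * f y - (2 * ∫ x in (0:ℝ)..π, x * f x) * (y * f y) := by
    intro y
    have : ∀ x : ℝ, |x - y| ^ 2 * (Real.sin (k * x) * Real.sin (n * x) *
          Real.sin (k * y) * Real.sin (n * y)) =
        f y * (x ^ 2 * f x) - (2 * y * f y) * (x * f x) + (y ^ 2 * f y) * f x := by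
      intro x; rw [sq_abs]; simp only [hf]; ring
    simp_rw [this]
    rw [intervalIntegral.integral_add (Continuous.intervalIntegrable (by fun_prop) _ _)
      (Continuous.intervalIntegrable (by fun_prop) _ _),
      intervalIntegral.integral_sub (Continuous.intervalIntegrable (by fun_prop) _ _)
      (Continuous.intervalIntegrable (by fun_prop) _ _), intervalIntegral.integral_const_mul,
      intervalIntegral.integral_const_mul, intervalIntegral.integral_const_mul, M0]
    ring
  simp_rw [inner]
  rw [intervalIntegral.integral_sub (Continuous.intervalIntegrable (by fun_prop) _ _)
      (Continuous.intervalIntegrable (by fun_prop) _ _), intervalIntegral.integral_const_mul,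
      intervalIntegral.integral_const_mul, M0, M1]
  have e : (n:ℝ) ^ 2 - (k:ℝ) ^ 2 = -(((k:ℝ) - n) * (k + n)) := by ring
  rw [e]
  field_simp
  ring
end

section
/- Let k and n be distinct positive integers with |k - n| even. Then N_{k,n} := ∫₀^π ∫₀^π |x - y|² · sin(kx) sin(nx) sin(ky) sin(ny) dx dy = 0. -/
open Real

lemma aux_A0 (k n : ℕ) (hk : 0 < k) (hkn : k ≠ n) :
    ∫ x in (0 : ℝ)..π, Real.sin (k * x) * Real.sin (n * x) = 0 := by
  have h1 : (k : ℝ) - n ≠ 0 := sub_ne_zero.mpr (by exact_mod_cast hkn)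
  have h2 : (k : ℝ) + n ≠ 0 := by positivity
  have hd : ∀ x ∈ Set.uIcc (0 : ℝ) π, HasDerivAt (fun x : ℝ =>
      Real.sin (((k : ℝ) - n) * x) / (2 * ((k : ℝ) - n)) -
      Real.sin (((k : ℝ) + n) * x) / (2 * ((k : ℝ) + n)))
      (Real.sin (k * x) * Real.sin (n * x)) x := by
    intro x _
    have e1 := (((hasDerivAt_id x).const_mul ((k : ℝ) - n)).sin).div_const (2 * ((k : ℝ) - n))
    have e2 := (((hasDerivAt_id x).const_mul ((k : ℝ) + n)).sin).div_const (2 * ((k : ℝ) + n))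
    refine (e1.sub e2).congr_deriv ?_
    simp only [id, mul_one]
    have c1 : Real.cos (((k : ℝ) - n) * x) * ((k : ℝ) - n) / (2 * ((k : ℝ) - n))
        = Real.cos (((k : ℝ) - n) * x) / 2 := by field_simp
    have c2 : Real.cos (((k : ℝ) + n) * x) * ((k : ℝ) + n) / (2 * ((k : ℝ) + n))
        = Real.cos (((k : ℝ) + n) * x) / 2 := by field_simp
    rw [c1, c2, sub_mul, add_mul, Real.cos_sub, Real.cos_add]
    ring
  rw [intervalIntegral.integral_eq_sub_of_hasDerivAt hd
    (Continuous.intervalIntegrable (by fun_prop) _ _)]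
  have s1 : Real.sin (((k : ℝ) - n) * π) = 0 := by
    have := Real.sin_int_mul_pi ((k : ℤ) - n)
    push_cast at this; exact this
  have s2 : Real.sin (((k : ℝ) + n) * π) = 0 := by
    have := Real.sin_nat_mul_pi (k + n)
    push_cast at this; exact this
  simp [s1, s2]

lemma aux_A1 (k n : ℕ) (hk : 0 < k) (hkn : k ≠ n) (heven : Even ((k : ℤ) - n)) :
    ∫ x in (0 : ℝ)..π, x * (Real.sin (k * x) * Real.sin (n * x)) = 0 := by
  have h0 := aux_A0 k n hk hkn
  have hf : ∀ x : ℝ, Real.sin (k * (π - x)) * Real.sin (n * (π - x)) =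
      Real.sin (k * x) * Real.sin (n * x) := by
    intro x
    rw [mul_sub, mul_sub, Real.sin_nat_mul_pi_sub, Real.sin_nat_mul_pi_sub]
    have : ((-1 : ℝ)) ^ k * (-1) ^ n = 1 := by
      rw [← pow_add]
      apply Even.neg_one_pow
      rw [Int.even_sub] at heven
      rw [Nat.even_add]
      exact_mod_cast heven
    linear_combination (Real.sin (k * x) * Real.sin (n * x)) * this
  have hs := intervalIntegral.integral_comp_sub_left (a := 0) (b := π)
    (fun x : ℝ => x * (Real.sin (k * x) * Real.sin (n * x))) π
  simp only [hf, sub_self, sub_zero, sub_mul] at hs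
  rw [intervalIntegral.integral_sub (Continuous.intervalIntegrable (by fun_prop) _ _)
    (Continuous.intervalIntegrable (by fun_prop) _ _),
    intervalIntegral.integral_const_mul, h0] at hs
  linarith

/-- For distinct positive integers `k`, `n` with `|k - n|` even,
`N_{k,n} = ∫₀^π ∫₀^π |x - y|² sin(kx) sin(nx) sin(ky) sin(ny) dx dy = 0`. -/
theorem stmt_10 (k n : ℕ) (hk : 0 < k) (hn : 0 < n) (hkn : k ≠ n)
    (heven : Even ((k : ℤ) - n)) :
    ∫ y in (0 : ℝ)..π, ∫ x in (0 : ℝ)..π,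
        |x - y| ^ 2 * (Real.sin (k * x) * Real.sin (n * x) *
          Real.sin (k * y) * Real.sin (n * y)) = 0 := by
  have h0 := aux_A0 k n hk hkn
  have h1 := aux_A1 k n hk hkn heven
  have hin : ∀ y : ℝ, ∫ x in (0 : ℝ)..π,
        |x - y| ^ 2 * (Real.sin (k * x) * Real.sin (n * x) *
          Real.sin (k * y) * Real.sin (n * y)) =
      (∫ x in (0 : ℝ)..π, x ^ 2 * (Real.sin (k * x) * Real.sin (n * x))) *
        (Real.sin (k * y) * Real.sin (n * y)) := by
    intro y
    have e : ∀ x : ℝ, |x - y| ^ 2 * (Real.sin (k * x) * Real.sin (n * x) *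
          Real.sin (k * y) * Real.sin (n * y)) =
        (x ^ 2 * (Real.sin (k * x) * Real.sin (n * x))
          - 2 * y * (x * (Real.sin (k * x) * Real.sin (n * x)))
          + y ^ 2 * (Real.sin (k * x) * Real.sin (n * x))) *
          (Real.sin (k * y) * Real.sin (n * y)) := by
      intro x; rw [sq_abs]; ring
    simp only [e]
    rw [intervalIntegral.integral_mul_const,
      intervalIntegral.integral_add (Continuous.intervalIntegrable (by fun_prop) _ _)
        (Continuous.intervalIntegrable (by fun_prop) _ _),
      intervalIntegral.integral_sub (Continuous.intervalIntegrable (by fun_prop) _ _)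
        (Continuous.intervalIntegrable (by fun_prop) _ _),
      intervalIntegral.integral_const_mul, intervalIntegral.integral_const_mul, h0, h1]
    ring
  simp only [hin]
  rw [intervalIntegral.integral_const_mul, h0, mul_zero]
end

section
/- Let n be a positive integer. Then ∫₀^π ∫₀^π |x - y|² · sin²(nx) · sin²(ny) dx dy = π⁴/24 - π²/(4n²). -/
open Real

lemma aux_quad (n : ℕ) (hn : 0 < n) (a b c : ℝ) :
    ∫ x in (0 : ℝ)..π, (a * x ^ 2 + b * x + c) * Real.sin (n * x) ^ 2 =
      a * (π ^ 3 / 6 - π / (4 * (n : ℝ) ^ 2)) + b * (π ^ 2 / 4) + c * (π / 2) := by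
  have hn' : (n : ℝ) ≠ 0 := by positivity
  have key : ∀ x ∈ Set.uIcc (0 : ℝ) π, HasDerivAt (fun x : ℝ =>
      a * (x ^ 3 / 6 - x ^ 2 * Real.sin (2 * n * x) / (4 * n)
        - x * Real.cos (2 * n * x) / (4 * n ^ 2) + Real.sin (2 * n * x) / (8 * n ^ 3))
      + b * (x ^ 2 / 4 - x * Real.sin (2 * n * x) / (4 * n) - Real.cos (2 * n * x) / (8 * n ^ 2))
      + c * (x / 2 - Real.sin (2 * n * x) / (4 * n)))
      ((a * x ^ 2 + b * x + c) * Real.sin (n * x) ^ 2) x := by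
    intro x _
    have hl : HasDerivAt (fun x : ℝ => 2 * (n : ℝ) * x) (2 * n) x := by
      simpa using (hasDerivAt_id x).const_mul (2 * (n : ℝ))
    have hs := hl.sin
    have hc := hl.cos
    have h1 := hasDerivAt_id' x
    have h2 := hasDerivAt_pow 2 x
    have h3 := hasDerivAt_pow 3 x
    have H := (((((h3.div_const 6).sub ((h2.mul hs).div_const (4 * (n : ℝ)))).sub
      ((h1.mul hc).div_const (4 * (n : ℝ) ^ 2))).add (hs.div_const (8 * (n : ℝ) ^ 3))).const_mul a).add
      ((((h2.div_const 4).sub ((h1.mul hs).div_const (4 * (n : ℝ)))).sub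
        (hc.div_const (8 * (n : ℝ) ^ 2))).const_mul b) |>.add
      (((h1.div_const 2).sub (hs.div_const (4 * (n : ℝ)))).const_mul c)
    refine H.congr_deriv ?_
    have hsq : Real.sin (n * x) ^ 2 = 1 / 2 - Real.cos (2 * n * x) / 2 := by
      rw [Real.sin_sq_eq_half_sub, mul_assoc]
    rw [hsq]
    push_cast
    field_simp
    ring
  rw [intervalIntegral.integral_eq_sub_of_hasDerivAt key
    (Continuous.intervalIntegrable (by fun_prop) _ _)]
  have e1 : Real.sin (2 * n * π) = 0 := by
    have := Real.sin_nat_mul_pi (2 * n)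
    push_cast at this
    exact this
  have e2 : Real.cos (2 * n * π) = 1 := by
    have := Real.cos_nat_mul_two_pi n
    rw [← this]; congr 1; ring
  simp only [e1, e2, mul_zero, Real.sin_zero, Real.cos_zero]
  field_simp
  ring

/-- For a positive integer `n`,
`∫₀^π ∫₀^π |x - y|² sin²(nx) sin²(ny) dx dy = π⁴/24 - π²/(4n²)`. -/
theorem stmt_11 (n : ℕ) (hn : 0 < n) :
    ∫ y in (0 : ℝ)..π, ∫ x in (0 : ℝ)..π,
        |x - y| ^ 2 * (Real.sin (n * x) ^ 2 * Real.sin (n * y) ^ 2) =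
      π ^ 4 / 24 - π ^ 2 / (4 * (n : ℝ) ^ 2) := by
  have hn' : (n : ℝ) ≠ 0 := by positivity
  have inner : ∀ y : ℝ, ∫ x in (0 : ℝ)..π,
        |x - y| ^ 2 * (Real.sin (n * x) ^ 2 * Real.sin (n * y) ^ 2) =
      ((π / 2) * y ^ 2 + (-(π ^ 2 / 2)) * y + (π ^ 3 / 6 - π / (4 * (n : ℝ) ^ 2)))
        * Real.sin (n * y) ^ 2 := by
    intro y
    have h : ∀ x : ℝ, |x - y| ^ 2 * (Real.sin (n * x) ^ 2 * Real.sin (n * y) ^ 2) =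
        ((1 * x ^ 2 + (-2 * y) * x + y ^ 2) * Real.sin (n * x) ^ 2) * Real.sin (n * y) ^ 2 := by
      intro x
      rw [sq_abs]; ring
    simp only [h]
    rw [intervalIntegral.integral_mul_const, aux_quad n hn]
    ring
  simp only [inner]
  rw [aux_quad n hn]
  field_simp
  ring
end

section
/- Let a and b be positive integers. Then ∫₀^π ∫₀^π |x - y| · cos(ax) · cos(by) dx dy equals -π/a² if a = b, and equals 0 if a ≠ b. -/
open Real

lemma aux_cos (m : ℤ) (hm : m ≠ 0) : ∫ y in (0 : ℝ)..π, Real.cos (m * y) = 0 := by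
  have hm' : (m : ℝ) ≠ 0 := by exact_mod_cast hm
  rw [intervalIntegral.integral_comp_mul_left (fun y => Real.cos y) hm']
  simp [Real.sin_int_mul_pi]

lemma aux_F (c y p q : ℝ) (hc : c ≠ 0) : ∫ x in p..q, (x - y) * Real.cos (c * x) =
    ((q - y) * Real.sin (c * q) / c + Real.cos (c * q) / c ^ 2) -
    ((p - y) * Real.sin (c * p) / c + Real.cos (c * p) / c ^ 2) := by
  apply intervalIntegral.integral_eq_sub_of_hasDerivAt
    (f := fun x => (x - y) * Real.sin (c * x) / c + Real.cos (c * x) / c ^ 2)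
  · intro x _
    have h0 : HasDerivAt (fun x : ℝ => c * x) c x := by
      simpa using (hasDerivAt_id x).const_mul c
    have h1 := ((((hasDerivAt_id x).sub_const y).mul h0.sin).div_const c).add
      (h0.cos.div_const (c ^ 2))
    refine h1.congr_deriv ?_
    simp only [id]
    field_simp
    ring
  · exact Continuous.intervalIntegrable (by fun_prop) _ _

lemma aux_inner (a : ℕ) (ha : 0 < a) (y : ℝ) (h0 : 0 ≤ y) (h1 : y ≤ π) :
    ∫ x in (0 : ℝ)..π, |x - y| * Real.cos (a * x) =
      (1 + Real.cos (a * π)) / (a : ℝ) ^ 2 - 2 / (a : ℝ) ^ 2 * Real.cos (a * y) := by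
  have hc : (a : ℝ) ≠ 0 := by exact_mod_cast ha.ne'
  have hi : ∀ p q : ℝ, IntervalIntegrable (fun x : ℝ => |x - y| * Real.cos (a * x))
      MeasureTheory.volume p q := fun p q =>
    Continuous.intervalIntegrable (by fun_prop) _ _
  rw [← intervalIntegral.integral_add_adjacent_intervals (hi 0 y) (hi y π)]
  have e1 : ∫ x in (0 : ℝ)..y, |x - y| * Real.cos (a * x) =
      ∫ x in (0 : ℝ)..y, -((x - y) * Real.cos (a * x)) := by
    apply intervalIntegral.integral_congr
    intro x hx
    rw [Set.uIcc_of_le h0] at hx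
    simp only
    rw [abs_of_nonpos (by linarith [hx.2])]
    ring
  have e2 : ∫ x in y..π, |x - y| * Real.cos (a * x) =
      ∫ x in y..π, (x - y) * Real.cos (a * x) := by
    apply intervalIntegral.integral_congr
    intro x hx
    rw [Set.uIcc_of_le h1] at hx
    simp only
    rw [abs_of_nonneg (by linarith [hx.1])]
  rw [e1, e2, intervalIntegral.integral_neg, aux_F _ _ _ _ hc, aux_F _ _ _ _ hc]
  simp only [Real.sin_nat_mul_pi, mul_zero, Real.sin_zero, Real.cos_zero]
  ring

lemma aux_outer (a b : ℕ) (ha : 0 < a) (hb : 0 < b) :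
    ∫ y in (0 : ℝ)..π, ∫ x in (0 : ℝ)..π,
          |x - y| * (Real.cos (a * x) * Real.cos (b * y)) =
    -(1 / (a : ℝ) ^ 2) * ∫ y in (0 : ℝ)..π, Real.cos (((a : ℤ) - b : ℤ) * y) := by
  have e : ∫ y in (0 : ℝ)..π, ∫ x in (0 : ℝ)..π,
          |x - y| * (Real.cos (a * x) * Real.cos (b * y)) =
      ∫ y in (0 : ℝ)..π, ((1 + Real.cos (a * π)) / (a : ℝ) ^ 2 * Real.cos ((b : ℤ) * y)
        + (-(1 / (a : ℝ) ^ 2) * Real.cos (((a : ℤ) - b : ℤ) * y)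
        + -(1 / (a : ℝ) ^ 2) * Real.cos (((a : ℤ) + b : ℤ) * y))) := by
    apply intervalIntegral.integral_congr
    intro y hy
    rw [Set.uIcc_of_le Real.pi_pos.le] at hy
    simp only [← mul_assoc]
    rw [intervalIntegral.integral_mul_const, aux_inner a ha y hy.1 hy.2]
    push_cast
    rw [sub_mul (a : ℝ), add_mul (a : ℝ), Real.cos_sub, Real.cos_add]
    ring
  rw [e, intervalIntegral.integral_add, intervalIntegral.integral_add]
  · simp only [intervalIntegral.integral_const_mul]
    rw [aux_cos (b : ℤ) (by omega), aux_cos ((a : ℤ) + b) (by omega)]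
    ring
  all_goals exact Continuous.intervalIntegrable (by fun_prop) _ _

/-- For positive integers `a`, `b`, the double integral
`∫₀^π ∫₀^π |x - y| cos(ax) cos(by) dx dy` equals `-π/a²` if `a = b`
and `0` if `a ≠ b`. -/
theorem stmt_13 (a b : ℕ) (ha : 0 < a) (hb : 0 < b) :
    (a = b →
      ∫ y in (0 : ℝ)..π, ∫ x in (0 : ℝ)..π,
          |x - y| * (Real.cos (a * x) * Real.cos (b * y)) = -π / (a : ℝ) ^ 2) ∧
    (a ≠ b →
      ∫ y in (0 : ℝ)..π, ∫ x in (0 : ℝ)..π,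
          |x - y| * (Real.cos (a * x) * Real.cos (b * y)) = 0) := by
  rw [aux_outer a b ha hb]
  constructor
  · intro h
    subst h
    simp
    ring
  · intro h
    rw [aux_cos _ (by omega), mul_zero]
end

section
/- Let k and n be distinct positive integers. Then M_{k,n} := ∫₀^π ∫₀^π |x - y| · sin(kx) sin(nx) sin(ky) sin(ny) dx dy = -(π/2) · (k² + n²) / (n² - k²)². -/
open Real

theorem aux_main (a b : ℝ) (ha : a ≠ 0) (hb : b ≠ 0) (hab : b ^ 2 - a ^ 2 ≠ 0)
    (hsa : Real.sin (a * π) = 0) (hsb : Real.sin (b * π) = 0) :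
    ∫ y in (0 : ℝ)..π, ∫ x in (0 : ℝ)..π,
        |x - y| * (((Real.cos (a * x) - Real.cos (b * x)) / 2) *
          ((Real.cos (a * y) - Real.cos (b * y)) / 2)) = -(π / 4) * (1 / a ^ 2 + 1 / b ^ 2) := by
  have dS : ∀ c x : ℝ, HasDerivAt (fun x => Real.sin (c * x)) (Real.cos (c * x) * c) x := by
    intro c x
    have h := ((hasDerivAt_id x).const_mul c).sin
    simpa using h
  have dC : ∀ c x : ℝ, HasDerivAt (fun x => Real.cos (c * x)) (-Real.sin (c * x) * c) x := by
    intro c x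
    have h := ((hasDerivAt_id x).const_mul c).cos
    simpa using h
  obtain ⟨f, hf⟩ : ∃ f : ℝ → ℝ, f = fun x => (Real.cos (a * x) - Real.cos (b * x)) / 2 := ⟨_, rfl⟩
  obtain ⟨F, hF⟩ : ∃ F : ℝ → ℝ, F = fun x => (Real.sin (a * x) / a - Real.sin (b * x) / b) / 2 :=
    ⟨_, rfl⟩
  obtain ⟨G, hG⟩ : ∃ G : ℝ → ℝ, G = fun x =>
    (Real.cos (b * x) / b ^ 2 - Real.cos (a * x) / a ^ 2) / 2 := ⟨_, rfl⟩
  obtain ⟨H, hH⟩ : ∃ H : ℝ → ℝ, H = fun x =>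
    ((x / 2 - Real.sin (a * x) * Real.cos (a * x) / (2 * a)) / a ^ 2
      + (x / 2 - Real.sin (b * x) * Real.cos (b * x) / (2 * b)) / b ^ 2
      - 2 / (a * b) * ((a * (Real.cos (a * x) * Real.sin (b * x))
        - b * (Real.sin (a * x) * Real.cos (b * x))) / (b ^ 2 - a ^ 2))) / 4 := ⟨_, rfl⟩
  have fc : Continuous f := by rw [hf]; fun_prop
  have dF : ∀ x, HasDerivAt F (f x) x := by
    intro x
    rw [hF, hf]
    refine ((((dS a x).div_const a).sub ((dS b x).div_const b)).div_const 2).congr_deriv ?_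
    field_simp
  have dG : ∀ x, HasDerivAt G (F x) x := by
    intro x
    rw [hG, hF]
    refine ((((dC b x).div_const (b^2)).sub ((dC a x).div_const (a^2))).div_const 2).congr_deriv ?_
    field_simp
    ring
  have dH : ∀ x, HasDerivAt H (F x ^ 2) x := by
    intro x
    rw [hH, hF]
    refine ((((((hasDerivAt_id x).div_const 2).sub
      (((dS a x).mul (dC a x)).div_const (2*a))).div_const (a^2)).add
      ((((hasDerivAt_id x).div_const 2).sub
      (((dS b x).mul (dC b x)).div_const (2*b))).div_const (b^2))).sub
      ((((((dC a x).mul (dS b x)).const_mul a).sub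
        (((dS a x).mul (dC b x)).const_mul b)).div_const (b^2-a^2)).const_mul
          (2/(a*b)))).div_const 4 |>.congr_deriv ?_
    beta_reduce
    have h1 := Real.cos_sq' (a * x)
    have h2 := Real.cos_sq' (b * x)
    generalize Real.cos (a * x) = ca at *
    generalize Real.cos (b * x) = cb at *
    generalize Real.sin (a * x) = sa at *
    generalize Real.sin (b * x) = sb at *
    have e1 : (1 / 2 - (ca * a * ca + sa * (-sa * a)) / (2 * a)) = sa ^ 2 := by
      field_simp
      linear_combination -h1
    have e2 : (1 / 2 - (cb * b * cb + sb * (-sb * b)) / (2 * b)) = sb ^ 2 := by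
      field_simp
      linear_combination -h2
    have e3 : (a * (-sa * a * sb + ca * (cb * b)) - b * (ca * a * cb + sa * (-sb * b)))
        / (b ^ 2 - a ^ 2) = sa * sb := by
      field_simp
      ring
    rw [e1, e2, e3]
    field_simp
    ring
  have inner : ∀ y ∈ Set.uIcc (0:ℝ) π, ∫ x in (0 : ℝ)..π, |x - y| * (f x * f y)
      = (2 * G y - G 0 - G π) * f y := by
    intro y hy
    rw [Set.uIcc_of_le pi_pos.le] at hy
    have dP : ∀ x, HasDerivAt (fun x => ((x - y) * F x - G x) * f y)
        ((x - y) * (f x * f y)) x := by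
      intro x
      refine (((((hasDerivAt_id x).sub_const y).mul (dF x)).sub (dG x)).mul_const (f y)).congr_deriv ?_
      simp only [id]
      ring
    have F0 : F 0 = 0 := by simp [hF]
    have Fp : F π = 0 := by simp [hF, hsa, hsb]
    rw [← intervalIntegral.integral_add_adjacent_intervals (b := y)
      ((by fun_prop : Continuous _).intervalIntegrable _ _)
      ((by fun_prop : Continuous _).intervalIntegrable _ _)]
    have i1 : ∫ x in (0:ℝ)..y, |x - y| * (f x * f y) = -∫ x in (0:ℝ)..y, (x - y) * (f x * f y) := by
      rw [← intervalIntegral.integral_neg]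
      apply intervalIntegral.integral_congr
      intro x hx
      rw [Set.uIcc_of_le hy.1] at hx
      simp only
      rw [abs_of_nonpos (by linarith [hx.2])]
      ring
    have i2 : ∫ x in y..π, |x - y| * (f x * f y) = ∫ x in y..π, (x - y) * (f x * f y) := by
      apply intervalIntegral.integral_congr
      intro x hx
      rw [Set.uIcc_of_le hy.2] at hx
      simp only
      rw [abs_of_nonneg (by linarith [hx.1])]
    rw [i1, i2, intervalIntegral.integral_eq_sub_of_hasDerivAt (fun x _ => dP x)
      ((by fun_prop : Continuous _).intervalIntegrable _ _),
      intervalIntegral.integral_eq_sub_of_hasDerivAt (fun x _ => dP x)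
      ((by fun_prop : Continuous _).intervalIntegrable _ _)]
    rw [F0, Fp]
    ring
  have F0 : F 0 = 0 := by simp [hF]
  have Fp : F π = 0 := by simp [hF, hsa, hsb]
  have H0 : H 0 = 0 := by simp [hH]
  have Hp : H π = π / 8 * (1 / a ^ 2 + 1 / b ^ 2) := by
    simp only [hH, hsa, hsb]
    ring
  have Gc : Continuous G := by rw [hG]; fun_prop
  have goal' : ∫ y in (0 : ℝ)..π, ∫ x in (0 : ℝ)..π, |x - y| * (f x * f y)
      = -(π / 4) * (1 / a ^ 2 + 1 / b ^ 2) := by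
    rw [intervalIntegral.integral_congr inner]
    have dQ : ∀ y, HasDerivAt (fun y => (2 * G y - G 0 - G π) * F y - 2 * H y)
        ((2 * G y - G 0 - G π) * f y) y := by
      intro y
      refine ((((((dG y).const_mul 2).sub_const (G 0)).sub_const (G π)).mul (dF y)).sub
        ((dH y).const_mul 2)).congr_deriv ?_
      ring
    rw [intervalIntegral.integral_eq_sub_of_hasDerivAt (fun x _ => dQ x)
      ((by fun_prop : Continuous _).intervalIntegrable _ _)]
    rw [F0, Fp, H0, Hp]
    ring
  rw [hf] at goal'
  exact goal'

/-- For distinct positive integers `k`, `n`,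
`M_{k,n} = ∫₀^π ∫₀^π |x - y| sin(kx) sin(nx) sin(ky) sin(ny) dx dy
         = -(π/2) (k² + n²) / (n² - k²)²`. -/
theorem stmt_14 (k n : ℕ) (hk : 0 < k) (hn : 0 < n) (hkn : k ≠ n) :
    ∫ y in (0 : ℝ)..π, ∫ x in (0 : ℝ)..π,
        |x - y| * (Real.sin (k * x) * Real.sin (n * x) *
          Real.sin (k * y) * Real.sin (n * y)) =
      -(π / 2) * ((k : ℝ) ^ 2 + (n : ℝ) ^ 2) / ((n : ℝ) ^ 2 - (k : ℝ) ^ 2) ^ 2 := by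
  have hk' : (0:ℝ) < k := by exact_mod_cast hk
  have hn' : (0:ℝ) < n := by exact_mod_cast hn
  have ha : (k:ℝ) - n ≠ 0 := sub_ne_zero.mpr (by exact_mod_cast hkn)
  have hb : (k:ℝ) + n ≠ 0 := by positivity
  have key : ∀ x : ℝ, Real.sin (k * x) * Real.sin (n * x)
      = (Real.cos (((k:ℝ) - n) * x) - Real.cos (((k:ℝ) + n) * x)) / 2 := by
    intro x
    rw [sub_mul, add_mul, Real.cos_sub, Real.cos_add]
    ring
  have h := aux_main (k - n) (k + n) ha hb
    (by
      have : ((k:ℝ) + n) ^ 2 - (k - n) ^ 2 = 4 * k * n := by ring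
      rw [this]; positivity)
    (by have := Real.sin_int_mul_pi ((k:ℤ) - n); push_cast at this; exact this)
    (by have := Real.sin_int_mul_pi ((k:ℤ) + n); push_cast at this; exact this)
  simp only [← key] at h
  simp only [← mul_assoc] at h ⊢
  rw [h]
  have e : (n:ℝ) ^ 2 - k ^ 2 = -((k - n) * (k + n)) := by ring
  rw [e]
  field_simp
  ring
end

section
/- Let n be a positive integer. Then ∫₀^π ∫₀^π |x - y| · sin²(nx) · sin²(ny) dx dy = π³/12 - 5π/(16 n²). -/
open Real

lemma aux_inner_s15 (a : ℝ) (ha : a ≠ 0) (y x : ℝ) :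
    HasDerivAt (fun x => (x-y)^2/4 - (x-y)*(sin (a*x) * cos (a*x))/(2*a)
      + sin (a*x)^2/(4*a^2)) ((x-y) * sin (a*x)^2) x := by
  have h0 : HasDerivAt (fun x : ℝ => a*x) a x := by simpa using (hasDerivAt_id x).const_mul a
  have hs := h0.sin
  have hc := h0.cos
  have hx : HasDerivAt (fun x : ℝ => x - y) 1 x := (hasDerivAt_id x).sub_const y
  have := (((hx.pow 2).div_const 4).sub ((hx.mul (hs.mul hc)).div_const (2*a))).add
    ((hs.pow 2).div_const (4*a^2))
  refine this.congr_deriv ?_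
  have h2 : cos (a*x)^2 = 1 - sin (a*x)^2 := by rw [← sin_sq_add_cos_sq (a*x)]; ring
  simp only [Pi.mul_apply]
  generalize sin (a*x) = s at h2 ⊢
  generalize cos (a*x) = c at h2 ⊢
  field_simp
  ring_nf
  simp only [h2]
  ring

lemma aux_outer_s15 (a : ℝ) (ha : a ≠ 0) (y : ℝ) :
    HasDerivAt (fun y => (y^3 - (π-y)^3)/24
      - 1/2 * (((π-y)^2+y^2)/4 * (sin (a*y) * cos (a*y))/a + (2*y-π)/2*(1-2*sin (a*y)^2)/(4*a^2)
        - (sin (a*y) * cos (a*y))/(4*a^3))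
      - 1/(2*a^2) * (-(sin (a*y)^3*cos (a*y))/(4*a) + 3/8*(y - sin (a*y) * cos (a*y)/a)))
      ((((π-y)^2+y^2)/4 - sin (a*y)^2/(2*a^2)) * sin (a*y)^2) y := by
  have h0 : HasDerivAt (fun x : ℝ => a*x) a y := by simpa using (hasDerivAt_id y).const_mul a
  have hs := h0.sin
  have hc := h0.cos
  have hx : HasDerivAt (fun x : ℝ => x) 1 y := hasDerivAt_id y
  have hp : HasDerivAt (fun x : ℝ => π - x) (-1) y := hx.const_sub π
  have hsc := hs.mul hc
  have := ((((hx.pow 3).sub (hp.pow 3)).div_const 24).sub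
    ((((((((hp.pow 2).add (hx.pow 2)).div_const 4).mul hsc).div_const a).add
      (((((hx.const_mul 2).sub_const π).div_const 2).mul
        (((hs.pow 2).const_mul 2).const_sub 1)).div_const (4*a^2))).sub
      (hsc.div_const (4*a^3))).const_mul (1/2))).sub
    (((((hs.pow 3).mul hc).neg.div_const (4*a)).add
      ((hx.sub (hsc.div_const a)).const_mul (3/8))).const_mul (1/(2*a^2)))
  refine this.congr_deriv ?_
  have h2 : cos (a*y)^2 = 1 - sin (a*y)^2 := by rw [← sin_sq_add_cos_sq (a*y)]; ring
  simp only [Pi.mul_apply, Pi.add_apply, Pi.pow_apply]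
  generalize sin (a*y) = s at h2 ⊢
  generalize cos (a*y) = c at h2 ⊢
  field_simp
  ring_nf
  simp only [h2]
  ring

lemma aux_int (a : ℝ) (hs : sin (a*π) = 0) (ha : a ≠ 0) (y : ℝ) (hy : y ∈ Set.Icc 0 π) :
    ∫ x in (0 : ℝ)..π, |x - y| * (sin (a * x) ^ 2 * sin (a * y) ^ 2)
      = (((π-y)^2+y^2)/4 - sin (a*y)^2/(2*a^2)) * sin (a*y)^2 := by
  have hcont : Continuous fun x => |x - y| * (sin (a * x) ^ 2 * sin (a * y) ^ 2) := by fun_prop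
  have hcont2 : Continuous fun x => (x - y) * sin (a * x) ^ 2 := by fun_prop
  have key := fun u v => intervalIntegral.integral_eq_sub_of_hasDerivAt (a := u) (b := v)
    (fun x _ => aux_inner_s15 a ha y x) (hcont2.intervalIntegrable _ _)
  rw [← intervalIntegral.integral_add_adjacent_intervals (b := y)
    (hcont.intervalIntegrable _ _) (hcont.intervalIntegrable _ _)]
  have e1 : ∫ x in (0 : ℝ)..y, |x - y| * (sin (a * x) ^ 2 * sin (a * y) ^ 2)
      = ∫ x in (0 : ℝ)..y, ((x - y) * sin (a * x) ^ 2) * (- sin (a * y) ^ 2) := by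
    apply intervalIntegral.integral_congr
    intro x hx
    rw [Set.uIcc_of_le hy.1] at hx
    simp only
    rw [abs_of_nonpos (by linarith [hx.2])]; ring
  have e2 : ∫ x in y..π, |x - y| * (sin (a * x) ^ 2 * sin (a * y) ^ 2)
      = ∫ x in y..π, ((x - y) * sin (a * x) ^ 2) * (sin (a * y) ^ 2) := by
    apply intervalIntegral.integral_congr
    intro x hx
    rw [Set.uIcc_of_le hy.2] at hx
    simp only
    rw [abs_of_nonneg (by linarith [hx.1])]; ring
  rw [e1, e2, intervalIntegral.integral_mul_const, intervalIntegral.integral_mul_const,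
    key, key, hs]
  simp only [mul_zero, sin_zero]
  field_simp
  ring

/-- For a positive integer `n`,
`∫₀^π ∫₀^π |x - y| sin²(nx) sin²(ny) dx dy = π³/12 - 5π/(16n²)`. -/
theorem stmt_15 (n : ℕ) (hn : 0 < n) :
    ∫ y in (0 : ℝ)..π, ∫ x in (0 : ℝ)..π,
        |x - y| * (Real.sin (n * x) ^ 2 * Real.sin (n * y) ^ 2) =
      π ^ 3 / 12 - 5 * π / (16 * (n : ℝ) ^ 2) := by
  have ha : (n : ℝ) ≠ 0 := by positivity
  have hs : sin ((n : ℝ) * π) = 0 := sin_nat_mul_pi n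
  have e : ∫ y in (0 : ℝ)..π, ∫ x in (0 : ℝ)..π,
        |x - y| * (Real.sin (n * x) ^ 2 * Real.sin (n * y) ^ 2) =
      ∫ y in (0 : ℝ)..π, (((π-y)^2+y^2)/4 - sin (n*y)^2/(2*(n:ℝ)^2)) * sin (n*y)^2 := by
    apply intervalIntegral.integral_congr
    intro y hy
    rw [Set.uIcc_of_le pi_pos.le] at hy
    exact aux_int n hs ha y hy
  have hcont : Continuous fun y : ℝ =>
      (((π-y)^2+y^2)/4 - sin (n*y)^2/(2*(n:ℝ)^2)) * sin (n*y)^2 := by fun_prop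
  rw [e, intervalIntegral.integral_eq_sub_of_hasDerivAt
    (fun y _ => aux_outer_s15 n ha y) (hcont.intervalIntegrable _ _), hs]
  simp only [mul_zero, sin_zero]
  field_simp
  ring
end

section
/- Let ε > 0 and let (τ_k)_{k≥1} be a sequence of nonzero complex numbers for which there exist c > 0 and K ∈ ℕ such that Im τ_k ≥ c·k for all k ≥ K. For each k ≥ 1 let A_k be the integral operator on L²(0, π) with kernel (i/π) · e^{i τ_k ε |x - y|} / τ_k · sin(kx) sin(ky). Then the series Σ_{k≥1} A_k converges in the operator norm of bounded operators on L²(0, π); in particular its sum is a bounded operator. -/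
open Real MeasureTheory

lemma aux_int_s17 (a x : ℝ) (ha : 0 < a) :
    Integrable (fun y : ℝ => rexp (-a * |x - y|)) ∧ ∫ y : ℝ, rexp (-a * |x - y|) = 2 / a := by
  have h0 : ∫ y : ℝ, rexp (-a * |y|) = 2 / a := by
    rw [integral_comp_abs (f := fun y => rexp (-a * y)), integral_exp_mul_Ioi (by linarith)]
    field_simp
    simp
  have h2 : Integrable (fun y : ℝ => rexp (-a * |y|)) := by
    by_contra h
    rw [integral_undef h] at h0
    have : 0 < 2 / a := by positivity
    linarith
  refine ⟨h2.comp_sub_left x, ?_⟩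
  rw [integral_sub_left_eq_self (fun y : ℝ => rexp (-a * |y|)) volume x, h0]

lemma aux_bound (m ε x : ℝ) (hm : 0 < m) (hε : 0 < ε) (s : Set ℝ)
    (f : Lp ℂ 2 (volume.restrict s)) :
    ∫ y, rexp (-(m * ε) * |x - y|) * ‖f y‖ ∂(volume.restrict s) ≤ √(1 / (m * ε)) * ‖f‖ := by
  obtain ⟨hi, he⟩ := aux_int_s17 (2 * (m * ε)) x (by positivity)
  have hsq : ∀ y, rexp (-(m * ε) * |x - y|) ^ (2:ℝ) = rexp (-(2 * (m * ε)) * |x - y|) := by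
    intro y
    rw [← Real.exp_mul]; congr 1; ring
  have hg : MemLp (fun y => rexp (-(m * ε) * |x - y|)) (ENNReal.ofReal 2) (volume.restrict s) := by
    rw [show ENNReal.ofReal 2 = 2 by norm_num]
    rw [memLp_two_iff_integrable_sq (by fun_prop)]
    refine (hi.integrableOn (s := s)).congr (Filter.Eventually.of_forall fun y => ?_)
    simp only [← hsq]
    norm_cast
  have hf : MemLp (fun y => ‖f y‖) (ENNReal.ofReal 2) (volume.restrict s) := by
    rw [show ENNReal.ofReal 2 = 2 by norm_num]
    exact (Lp.memLp f).norm
  have h := integral_mul_le_Lp_mul_Lq_of_nonneg (μ := volume.restrict s)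
    Real.HolderConjugate.two_two
    (Filter.Eventually.of_forall fun y => (Real.exp_pos (-(m * ε) * |x - y|)).le)
    (Filter.Eventually.of_forall fun y => norm_nonneg (f y)) hg hf
  refine h.trans ?_
  rw [← Real.sqrt_eq_rpow, ← Real.sqrt_eq_rpow]
  have hfn : √(∫ y, ‖f y‖ ^ (2:ℝ) ∂(volume.restrict s)) = ‖f‖ := by
    rw [Real.sqrt_eq_iff_eq_sq (integral_nonneg fun y => by positivity) (norm_nonneg _)]
    have := L2.inner_def (𝕜 := ℂ) f f
    rw [inner_self_eq_norm_sq_to_K] at this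
    simp only [inner_self_eq_norm_sq_to_K] at this
    have h2 : ((‖f‖ ^ 2 : ℝ) : ℂ) = ((∫ y, ‖f y‖ ^ 2 ∂(volume.restrict s) : ℝ) : ℂ) := by
      rw [← integral_complex_ofReal]
      push_cast
      exact this
    have h3 := Complex.ofReal_injective h2
    rw [h3]
    norm_cast
  rw [hfn]
  gcongr
  simp only [hsq]
  refine (integral_mono_measure (Measure.restrict_le_self) 
    (Filter.Eventually.of_forall fun y => (Real.exp_pos _).le) hi).trans ?_
  rw [he]
  apply le_of_eq
  field_simp

/-- Norm convergence of the series defining the (second-sheet) embedded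
resolvent: let `ε > 0` and let `(τ_k)_{k ≥ 1}` be nonzero complex numbers with
`Im τ_k ≥ c k` for all `k ≥ K` (some `c > 0`, `K`). If `A_k` is the integral
operator on `L²(0, π)` with kernel
`(i/π) e^{i τ_k ε |x - y|} / τ_k · sin(kx) sin(ky)`, then `Σ_k A_k` converges
in the operator norm; in particular its sum is a bounded operator. -/
theorem stmt_17 (ε : ℝ) (hε : 0 < ε) (τ : ℕ+ → ℂ) (hτ : ∀ k : ℕ+, τ k ≠ 0)
    (hIm : ∃ c : ℝ, 0 < c ∧ ∃ K : ℕ+, ∀ k : ℕ+, K ≤ k → c * (k : ℕ) ≤ (τ k).im)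
    (A : ℕ+ → (Lp ℂ 2 (volume.restrict (Set.Ioo (0 : ℝ) π)) →L[ℂ]
      Lp ℂ 2 (volume.restrict (Set.Ioo (0 : ℝ) π))))
    (hA : ∀ k : ℕ+, ∀ f : Lp ℂ 2 (volume.restrict (Set.Ioo (0 : ℝ) π)),
      ∀ᵐ x ∂(volume.restrict (Set.Ioo (0 : ℝ) π)),
        (A k f : ℝ → ℂ) x =
          ∫ y, (Complex.I / (π : ℂ)) *
              Complex.exp (Complex.I * τ k * (ε : ℂ) * ((|x - y| : ℝ) : ℂ)) / τ k *
              ((Real.sin ((k : ℕ) * x) : ℝ) : ℂ) * ((Real.sin ((k : ℕ) * y) : ℝ) : ℂ) *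
              f y ∂(volume.restrict (Set.Ioo (0 : ℝ) π))) :
    Summable A := by
  obtain ⟨c, hc, K, hK⟩ := hIm
  set M : ℝ := (measureUnivNNReal (volume.restrict (Set.Ioo (0 : ℝ) π)) : ℝ) ^ (2 : ENNReal).toReal⁻¹ with hM
  have hM0 : 0 ≤ M := by positivity
  have hsum : Summable (fun k : ℕ+ => (M * ((1 / (π * c)) * √(1 / (c * ε)))) *
      (1 / ((k : ℕ) : ℝ) ^ (3 / 2 : ℝ))) := by
    apply Summable.mul_left
    exact (Real.summable_one_div_nat_rpow.2 (by norm_num : (1:ℝ) < 3 / 2)).comp_injective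
      PNat.coe_injective
  refine Summable.of_norm_bounded_eventually hsum ?_
  have hfin : {k : ℕ+ | ¬ K ≤ k}.Finite := by
    refine (Set.finite_Icc (1 : ℕ+) K).subset fun k hk => ?_
    exact ⟨one_le, (not_le.1 hk).le⟩
  have hev : ∀ᶠ k in Filter.cofinite, K ≤ k := hfin
  filter_upwards [hev] with k hk
  have hkpos : (0 : ℝ) < (k : ℕ) := by exact_mod_cast k.pos
  have hm : 0 < c * ((k : ℕ) : ℝ) := by positivity
  have him := hK k hk
  set m : ℝ := c * ((k : ℕ) : ℝ) with hmdef
  have hτn : m ≤ ‖τ k‖ := him.trans ((le_abs_self _).trans (Complex.abs_im_le_norm _))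
  have hconst : (M * ((1 / (π * c)) * √(1 / (c * ε)))) * (1 / ((k : ℕ) : ℝ) ^ (3 / 2 : ℝ))
      = M * ((1 / (π * m)) * √(1 / (m * ε))) := by
    have e1 : ((k : ℕ) : ℝ) ^ (3 / 2 : ℝ) = (k : ℕ) * √((k : ℕ) : ℝ) := by
      rw [show (3 / 2 : ℝ) = 1 + 1 / 2 by norm_num, Real.rpow_add hkpos, Real.rpow_one,
        Real.sqrt_eq_rpow]
    have e2 : √(1 / (m * ε)) = √(1 / (c * ε)) * (1 / √((k : ℕ) : ℝ)) := by
      rw [show 1 / (m * ε) = (1 / (c * ε)) * (1 / ((k : ℕ) : ℝ)) by rw [hmdef]; field_simp,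
        Real.sqrt_mul (by positivity), Real.sqrt_div zero_le_one (((k : ℕ) : ℝ)), Real.sqrt_one]
    rw [e1, e2, hmdef]
    have : 0 < √((k : ℕ) : ℝ) := Real.sqrt_pos.2 hkpos
    field_simp
  rw [hconst]
  refine ContinuousLinearMap.opNorm_le_bound _ (by positivity) fun f => ?_
  have hpt : ∀ᵐ x ∂(volume.restrict (Set.Ioo (0 : ℝ) π)), ‖(A k f : ℝ → ℂ) x‖ ≤ (1 / (π * m)) * √(1 / (m * ε)) * ‖f‖ := by
    filter_upwards [hA k f] with x hx
    rw [hx]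
    have hb := aux_bound m ε x hm hε _ f
    have hint : Integrable (fun y => (1 / (π * m)) * (rexp (-(m * ε) * |x - y|) * ‖f y‖)) (volume.restrict (Set.Ioo (0 : ℝ) π)) := by
      apply Integrable.const_mul
      have hfi : Integrable (fun y => ‖f y‖) (volume.restrict (Set.Ioo (0 : ℝ) π)) :=
        ((Lp.memLp f).integrable (by norm_num)).norm
      refine hfi.bdd_mul (c := 1) (by fun_prop) (Filter.Eventually.of_forall fun y => ?_)
      rw [Real.norm_eq_abs, Real.abs_exp, Real.exp_le_one_iff]
      have : 0 ≤ m * ε * |x - y| := by positivity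
      linarith
    refine (norm_integral_le_of_norm_le hint (Filter.Eventually.of_forall fun y => ?_)).trans ?_
    · have hexp : ‖Complex.exp (Complex.I * τ k * (ε : ℂ) * ((|x - y| : ℝ) : ℂ))‖
          ≤ rexp (-(m * ε) * |x - y|) := by
        rw [Complex.norm_exp]
        apply Real.exp_le_exp.2
        have : (Complex.I * τ k * (ε : ℂ) * ((|x - y| : ℝ) : ℂ)).re
            = -((τ k).im * ε) * |x - y| := by
          simp
        rw [this]
        have : m * ε * |x - y| ≤ (τ k).im * ε * |x - y| := by gcongr
        linarith
      have hs : ∀ t : ℝ, ‖((Real.sin t : ℝ) : ℂ)‖ ≤ 1 := fun t => by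
        rw [Complex.norm_real]; exact Real.abs_sin_le_one t
      have hIπ : ‖Complex.I / (π : ℂ)‖ = 1 / π := by
        rw [norm_div, Complex.norm_I, Complex.norm_real, Real.norm_of_nonneg Real.pi_pos.le]
      rw [norm_mul, norm_mul, norm_mul, norm_div, norm_mul, hIπ]
      calc 1 / π * ‖Complex.exp (Complex.I * τ k * (ε : ℂ) * ((|x - y| : ℝ) : ℂ))‖ / ‖τ k‖ *
            ‖((Real.sin ((k : ℕ) * x) : ℝ) : ℂ)‖ * ‖((Real.sin ((k : ℕ) * y) : ℝ) : ℂ)‖ * ‖f y‖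
          ≤ 1 / π * rexp (-(m * ε) * |x - y|) / m * 1 * 1 * ‖f y‖ := by
            gcongr
            · exact hs _
            · exact hs _
        _ = _ := by field_simp
    · rw [integral_const_mul, mul_assoc (1 / (π * m))]
      exact mul_le_mul_of_nonneg_left hb (by positivity)
  have h := Lp.norm_le_of_ae_bound (by positivity) hpt
  refine h.trans (le_of_eq ?_)
  rw [hM]; ring
end
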